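/- arXiv:2408.08233 — 2 statements merged into one kernel-verified Lean document; each statement's English description precedes it below -/
import Mathlib

section
/- First and size lower bounds (FLB and SzLB): Let (Z, d_Z) be a separable metric space, p ∈ [1,∞), z₀ ∈ Z, and let X, Y be (Z,p)-networks. Define the outgoing eccentricity ecc^out_{p,z₀,X}(x) = (∫_X d_Z(ω_X(x,x'), z₀)^p μ_X(dx'))^{1/p} and similarly for Y. Then GW_p^Z(X,Y) ≥ (1/2) W_p((ecc^out_{p,z₀,X})_*μ_X, (ecc^out_{p,z₀,Y})_*μ_Y) ≥ (1/2) |size_{p,z₀}(X) − size_{p,z₀}(Y)|, where W_p is the Wasserstein distance on ℝ with its standard metric. -/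
open MeasureTheory

noncomputable section

/-- The set of couplings of two measures: probability measures on the product
whose marginals are `μ` and `ν`. -/
def Couplings {X Y : Type*} [MeasurableSpace X] [MeasurableSpace Y]
    (μ : Measure X) (ν : Measure Y) : Set (Measure (X × Y)) :=
  {π | IsProbabilityMeasure π ∧ π.map Prod.fst = μ ∧ π.map Prod.snd = ν}

/-- The `p`-distortion of a coupling `π`, for kernels `ωX`, `ωY` valued in a
(pseudo)metric space `Z`. -/
def dis {X Y Z : Type*} [MeasurableSpace X] [MeasurableSpace Y] [PseudoMetricSpace Z]
    (p : ℝ) (ωX : X × X → Z) (ωY : Y × Y → Z) (π : Measure (X × Y)) : ℝ :=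
  (∫ w : X × Y, ∫ w' : X × Y,
      dist (ωX (w.1, w'.1)) (ωY (w.2, w'.2)) ^ p ∂π ∂π) ^ (1 / p)

/-- The `Z`-Gromov–Wasserstein `p`-distance between `(X, ωX, μX)` and `(Y, ωY, μY)`. -/
def GW {X Y Z : Type*} [MeasurableSpace X] [MeasurableSpace Y] [PseudoMetricSpace Z]
    (p : ℝ) (ωX : X × X → Z) (μX : Measure X) (ωY : Y × Y → Z) (μY : Measure Y) : ℝ :=
  (1 / 2) * sInf (dis p ωX ωY '' Couplings μX μY)

/-- `(X, ω, μ)` is a `(Z,p)`-network: `μ` is a Borel probability measure, `ω` is Borel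
measurable, and `∬ d_Z(ω(x,x'), z₀)^p dμ dμ < ∞` for some `z₀`. -/
structure IsNetwork {X Z : Type*} [MeasurableSpace X] [MeasurableSpace Z] [PseudoMetricSpace Z]
    (p : ℝ) (ω : X × X → Z) (μ : Measure X) : Prop where
  prob : IsProbabilityMeasure μ
  meas : Measurable ω
  integ : ∃ z₀ : Z, (∫⁻ x, ∫⁻ x', ENNReal.ofReal (dist (ω (x, x')) z₀ ^ p) ∂μ ∂μ) < ⊤

/-- The Wasserstein `p`-distance between two measures on a (pseudo)metric space. -/
def Wp {S : Type*} [MeasurableSpace S] [PseudoMetricSpace S]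
    (p : ℝ) (μ ν : Measure S) : ℝ :=
  sInf ((fun π : Measure (S × S) => (∫ q, dist q.1 q.2 ^ p ∂π) ^ (1 / p)) ''
    Couplings μ ν)

/-- The outgoing eccentricity function of a network relative to a base point. -/
def eccOut {X Z : Type*} [MeasurableSpace X] [PseudoMetricSpace Z]
    (p : ℝ) (ω : X × X → Z) (μ : Measure X) (z₀ : Z) (x : X) : ℝ :=
  (∫ x', dist (ω (x, x')) z₀ ^ p ∂μ) ^ (1 / p)

/-- The `p`-size of a network relative to a base point. -/
def sizeP {X Z : Type*} [MeasurableSpace X] [PseudoMetricSpace Z]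
    (p : ℝ) (ω : X × X → Z) (μ : Measure X) (z₀ : Z) : ℝ :=
  (∫ x, ∫ x', dist (ω (x, x')) z₀ ^ p ∂μ ∂μ) ^ (1 / p)

lemma memLp_ofReal_iff_integrable_rpow {Ω : Type*} [MeasurableSpace Ω] {μ : Measure Ω} {p : ℝ}
    (hp : 0 < p) {f : Ω → ℝ} (hf : Measurable f) (hf0 : ∀ x, 0 ≤ f x) :
    MemLp f (ENNReal.ofReal p) μ ↔ Integrable (fun x => f x ^ p) μ := by
  rw [← integrable_norm_rpow_iff hf.aestronglyMeasurable (by simpa using hp) (by simp)]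
  simp only [Real.norm_of_nonneg (hf0 _), ENNReal.toReal_ofReal hp.le]

lemma lpNorm_ofReal_eq_integral_rpow {Ω : Type*} [MeasurableSpace Ω] {μ : Measure Ω} {p : ℝ}
    (hp : 0 < p) {f : Ω → ℝ} (hf : Measurable f) (hf0 : ∀ x, 0 ≤ f x) :
    lpNorm f (ENNReal.ofReal p) μ = (∫ x, f x ^ p ∂μ) ^ (1 / p) := by
  rw [lpNorm_eq_integral_norm_rpow_toReal (by simpa using hp) (by simp) hf.aestronglyMeasurable]
  simp only [Real.norm_of_nonneg (hf0 _), ENNReal.toReal_ofReal hp.le, one_div]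

/-- Reverse Minkowski inequality, with the difference dominated by a third function. -/
lemma abs_integral_rpow_sub_integral_rpow_le {Ω : Type*} [MeasurableSpace Ω] {μ : Measure Ω}
    {p : ℝ} (hp : 1 ≤ p) {f g h : Ω → ℝ}
    (hf : Measurable f) (hg : Measurable g) (hh : Measurable h)
    (hf0 : ∀ x, 0 ≤ f x) (hg0 : ∀ x, 0 ≤ g x) (hfg : ∀ x, |f x - g x| ≤ h x)
    (hfi : Integrable (fun x => f x ^ p) μ) (hgi : Integrable (fun x => g x ^ p) μ)
    (hhi : Integrable (fun x => h x ^ p) μ) :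
    |(∫ x, f x ^ p ∂μ) ^ (1 / p) - (∫ x, g x ^ p ∂μ) ^ (1 / p)| ≤
      (∫ x, h x ^ p ∂μ) ^ (1 / p) := by
  have hp0 : 0 < p := by linarith
  have hh0 : ∀ x, 0 ≤ h x := fun x => (abs_nonneg _).trans (hfg x)
  rw [← memLp_ofReal_iff_integrable_rpow hp0 hf hf0] at hfi
  rw [← memLp_ofReal_iff_integrable_rpow hp0 hg hg0] at hgi
  rw [← memLp_ofReal_iff_integrable_rpow hp0 hh hh0] at hhi
  rw [← lpNorm_ofReal_eq_integral_rpow hp0 hf hf0, ← lpNorm_ofReal_eq_integral_rpow hp0 hg hg0,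
    ← lpNorm_ofReal_eq_integral_rpow hp0 hh hh0]
  have hp1 : 1 ≤ ENNReal.ofReal p := by simpa using hp
  have h1 := lpNorm_le_lpNorm_add_lpNorm_sub' (f := f) hgi hp1
  have h2 := lpNorm_le_lpNorm_add_lpNorm_sub (f := g) hfi hp1
  have h3 : lpNorm (f - g) (ENNReal.ofReal p) μ ≤ lpNorm h (ENNReal.ofReal p) μ :=
    lpNorm_mono_real hhi hfg
  rw [abs_le]
  constructor <;> linarith

lemma rpow_one_div_rpow {p a : ℝ} (hp : 1 ≤ p) (ha : 0 ≤ a) : (a ^ (1 / p)) ^ p = a := by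
  rw [one_div, Real.rpow_inv_rpow ha (by linarith)]

section Couplings

variable {X Y : Type*} [MeasurableSpace X] [MeasurableSpace Y] {μ : Measure X} {ν : Measure Y}

lemma Couplings.measurePreserving_fst {π : Measure (X × Y)} (hπ : π ∈ Couplings μ ν) :
    MeasurePreserving Prod.fst π μ :=
  ⟨measurable_fst, hπ.2.1⟩

lemma Couplings.measurePreserving_snd {π : Measure (X × Y)} (hπ : π ∈ Couplings μ ν) :
    MeasurePreserving Prod.snd π ν :=
  ⟨measurable_snd, hπ.2.2⟩

lemma Couplings.nonempty (μ : Measure X) (ν : Measure Y) [IsProbabilityMeasure μ]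
    [IsProbabilityMeasure ν] : (Couplings μ ν).Nonempty :=
  ⟨μ.prod ν, inferInstance, by simp, by simp⟩

lemma Couplings.map_prodMap {S T : Type*} [MeasurableSpace S] [MeasurableSpace T]
    {f : X → S} {g : Y → T} (hf : Measurable f) (hg : Measurable g)
    {π : Measure (X × Y)} (hπ : π ∈ Couplings μ ν) :
    π.map (Prod.map f g) ∈ Couplings (μ.map f) (ν.map g) := by
  have := hπ.1
  have hfg := hf.prodMap hg
  refine ⟨Measure.isProbabilityMeasure_map hfg.aemeasurable, ?_, ?_⟩
  · rw [Measure.map_map measurable_fst hfg, ← hπ.2.1, Measure.map_map hf measurable_fst]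
    rfl
  · rw [Measure.map_map measurable_snd hfg, ← hπ.2.2, Measure.map_map hg measurable_snd]
    rfl

end Couplings

/-- The Wasserstein distance on `ℝ` dominates the difference of the `p`-th absolute moments. -/
lemma abs_moment_sub_moment_le_Wp {p : ℝ} (hp : 1 ≤ p) {μ ν : Measure ℝ}
    [IsProbabilityMeasure μ] [IsProbabilityMeasure ν]
    (hμ : Integrable (fun x => |x| ^ p) μ) (hν : Integrable (fun x => |x| ^ p) ν) :
    |(∫ x, |x| ^ p ∂μ) ^ (1 / p) - (∫ x, |x| ^ p ∂ν) ^ (1 / p)| ≤ Wp p μ ν := by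
  have hp0 : 0 < p := by linarith
  refine le_csInf ((Couplings.nonempty μ ν).image _) ?_
  rintro _ ⟨π, hπ, rfl⟩
  have h1 := Couplings.measurePreserving_fst hπ
  have h2 := Couplings.measurePreserving_snd hπ
  have hm : Measurable fun x : ℝ => |x| ^ p := by fun_prop
  have hfi : Integrable (fun q : ℝ × ℝ => |q.1| ^ p) π := h1.integrable_comp_of_integrable hμ
  have hgi : Integrable (fun q : ℝ × ℝ => |q.2| ^ p) π := h2.integrable_comp_of_integrable hν
  have e1 : ∫ x, |x| ^ p ∂μ = ∫ q : ℝ × ℝ, |q.1| ^ p ∂π := by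
    rw [← h1.map_eq, integral_map h1.aemeasurable hm.aestronglyMeasurable]
  have e2 : ∫ x, |x| ^ p ∂ν = ∫ q : ℝ × ℝ, |q.2| ^ p ∂π := by
    rw [← h2.map_eq, integral_map h2.aemeasurable hm.aestronglyMeasurable]
  rw [e1, e2]
  have m1 : Measurable fun q : ℝ × ℝ => |q.1| := by fun_prop
  have m2 : Measurable fun q : ℝ × ℝ => |q.2| := by fun_prop
  have md : Measurable fun q : ℝ × ℝ => dist q.1 q.2 := by fun_prop
  refine abs_integral_rpow_sub_integral_rpow_le hp m1 m2 md (fun _ => abs_nonneg _)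
    (fun _ => abs_nonneg _) (fun q => abs_abs_sub_abs_le q.1 q.2) hfi hgi ?_
  rw [← memLp_ofReal_iff_integrable_rpow hp0 m1 fun _ => abs_nonneg _] at hfi
  rw [← memLp_ofReal_iff_integrable_rpow hp0 m2 fun _ => abs_nonneg _] at hgi
  rw [← memLp_ofReal_iff_integrable_rpow hp0 md fun _ => dist_nonneg]
  refine (hfi.add hgi).mono' md.aestronglyMeasurable (.of_forall fun q => ?_)
  rw [Real.norm_of_nonneg dist_nonneg, Real.dist_eq]
  exact abs_sub q.1 q.2

lemma abs_eccOut_rpow {X Z : Type*} [MeasurableSpace X] [PseudoMetricSpace Z] {p : ℝ}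
    (hp : 1 ≤ p) (ω : X × X → Z) (μ : Measure X) (z₀ : Z) (x : X) :
    |eccOut p ω μ z₀ x| ^ p = ∫ x', dist (ω (x, x')) z₀ ^ p ∂μ := by
  have h : 0 ≤ ∫ x', dist (ω (x, x')) z₀ ^ p ∂μ := integral_nonneg fun _ => by positivity
  rw [eccOut, abs_of_nonneg (by positivity), rpow_one_div_rpow hp h]

lemma Wp_le {S : Type*} [MeasurableSpace S] [PseudoMetricSpace S] {p : ℝ} {μ ν : Measure S}
    {π : Measure (S × S)} (hπ : π ∈ Couplings μ ν) :
    Wp p μ ν ≤ (∫ q, dist q.1 q.2 ^ p ∂π) ^ (1 / p) := by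
  refine csInf_le ⟨0, ?_⟩ (Set.mem_image_of_mem _ hπ)
  rintro _ ⟨σ, -, rfl⟩
  exact Real.rpow_nonneg (integral_nonneg fun _ => Real.rpow_nonneg dist_nonneg p) _

section Network

variable {X Y Z : Type*} [MeasurableSpace X] [MeasurableSpace Y] [MetricSpace Z]
  [MeasurableSpace Z] [BorelSpace Z] [TopologicalSpace.SeparableSpace Z]
  {p : ℝ} {ωX : X × X → Z} {μX : Measure X} {ωY : Y × Y → Z} {μY : Measure Y}

lemma IsNetwork.measurable_dist (hX : IsNetwork p ωX μX) (z₀ : Z) :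
    Measurable fun q => dist (ωX q) z₀ :=
  hX.meas.dist measurable_const

lemma IsNetwork.memLp_dist (hp : 1 ≤ p) (hX : IsNetwork p ωX μX) (z₀ : Z) :
    MemLp (fun q => dist (ωX q) z₀) (ENNReal.ofReal p) (μX.prod μX) := by
  have := hX.prob
  have hp0 : 0 < p := by linarith
  obtain ⟨z₁, hz₁⟩ := hX.integ
  have m (z : Z) := hX.measurable_dist z
  have h1 : MemLp (fun q => dist (ωX q) z₁) (ENNReal.ofReal p) (μX.prod μX) := by
    rw [memLp_ofReal_iff_integrable_rpow hp0 (m z₁) fun _ => dist_nonneg]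
    have mp : Measurable fun q => dist (ωX q) z₁ ^ p := (m z₁).pow_const p
    refine ⟨mp.aestronglyMeasurable, ?_⟩
    rw [hasFiniteIntegral_iff_ofReal (.of_forall fun _ => by positivity),
      lintegral_prod _ mp.ennreal_ofReal.aemeasurable]
    exact hz₁
  refine (h1.add (memLp_const (dist z₁ z₀))).mono' (m z₀).aestronglyMeasurable
    (.of_forall fun q => ?_)
  rw [Real.norm_of_nonneg dist_nonneg]
  exact dist_triangle _ _ _

lemma IsNetwork.integrable_dist_rpow (hp : 1 ≤ p) (hX : IsNetwork p ωX μX) (z₀ : Z) :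
    Integrable (fun q => dist (ωX q) z₀ ^ p) (μX.prod μX) :=
  (memLp_ofReal_iff_integrable_rpow (by linarith) (hX.measurable_dist z₀)
    fun _ => dist_nonneg).1 (hX.memLp_dist hp z₀)

lemma IsNetwork.measurable_eccOut (hX : IsNetwork p ωX μX) (z₀ : Z) :
    Measurable (eccOut p ωX μX z₀) := by
  have := hX.prob
  have h : StronglyMeasurable fun q => dist (ωX q) z₀ ^ p :=
    ((hX.measurable_dist z₀).pow_const p).stronglyMeasurable
  exact h.integral_prod_right'.measurable.pow_const _

lemma IsNetwork.integrable_map_eccOut (hp : 1 ≤ p) (hX : IsNetwork p ωX μX) (z₀ : Z) :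
    Integrable (fun t => |t| ^ p) (μX.map (eccOut p ωX μX z₀)) := by
  have := hX.prob
  have hm : Measurable fun x : ℝ => |x| ^ p := by fun_prop
  rw [integrable_map_measure hm.aestronglyMeasurable (hX.measurable_eccOut z₀).aemeasurable]
  exact (hX.integrable_dist_rpow hp z₀).integral_prod_left.congr
    (.of_forall fun x => (abs_eccOut_rpow hp ωX μX z₀ x).symm)

/-- The size of a network is the `p`-th moment of the law of its outgoing eccentricity. -/
lemma IsNetwork.sizeP_eq (hp : 1 ≤ p) (hX : IsNetwork p ωX μX) (z₀ : Z) :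
    sizeP p ωX μX z₀ = (∫ t, |t| ^ p ∂μX.map (eccOut p ωX μX z₀)) ^ (1 / p) := by
  have hm : Measurable fun x : ℝ => |x| ^ p := by fun_prop
  rw [integral_map (hX.measurable_eccOut z₀).aemeasurable hm.aestronglyMeasurable]
  simp only [abs_eccOut_rpow hp, sizeP]

lemma Wp_map_eccOut_le_dis (hp : 1 ≤ p) (hX : IsNetwork p ωX μX) (hY : IsNetwork p ωY μY)
    (z₀ : Z) {π : Measure (X × Y)} (hπ : π ∈ Couplings μX μY) :
    Wp p (μX.map (eccOut p ωX μX z₀)) (μY.map (eccOut p ωY μY z₀)) ≤ dis p ωX ωY π := by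
  have := hX.prob
  have := hY.prob
  have := hπ.1
  have hp0 : 0 < p := by linarith
  have mX := hX.measurable_eccOut z₀
  have mY := hY.measurable_eccOut z₀
  have h1 := Couplings.measurePreserving_fst hπ
  have h2 := Couplings.measurePreserving_snd hπ
  refine (Wp_le (Couplings.map_prodMap mX mY hπ)).trans ?_
  have md : Measurable fun q : ℝ × ℝ => dist q.1 q.2 ^ p := by fun_prop
  rw [integral_map (mX.prodMap mY).aemeasurable md.aestronglyMeasurable, dis]
  refine Real.rpow_le_rpow (integral_nonneg fun _ => by positivity) ?_ (by positivity)
  let F : (X × Y) × (X × Y) → ℝ := fun q => dist (ωX (q.1.1, q.2.1)) z₀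
  let G : (X × Y) × (X × Y) → ℝ := fun q => dist (ωY (q.1.2, q.2.2)) z₀
  let D : (X × Y) × (X × Y) → ℝ := fun q => dist (ωX (q.1.1, q.2.1)) (ωY (q.1.2, q.2.2))
  have mωX : Measurable fun q : (X × Y) × (X × Y) => ωX (q.1.1, q.2.1) :=
    hX.meas.comp (by fun_prop)
  have mωY : Measurable fun q : (X × Y) × (X × Y) => ωY (q.1.2, q.2.2) :=
    hY.meas.comp (by fun_prop)
  have mF : Measurable F := mωX.dist measurable_const
  have mG : Measurable G := mωY.dist measurable_const
  have mD : Measurable D := mωX.dist mωY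
  have lF : MemLp F (ENNReal.ofReal p) (π.prod π) :=
    (hX.memLp_dist hp z₀).comp_measurePreserving (h1.prod h1)
  have lG : MemLp G (ENNReal.ofReal p) (π.prod π) :=
    (hY.memLp_dist hp z₀).comp_measurePreserving (h2.prod h2)
  have lD : MemLp D (ENNReal.ofReal p) (π.prod π) := by
    refine (lF.add lG).mono' mD.aestronglyMeasurable (.of_forall fun q => ?_)
    rw [Real.norm_of_nonneg dist_nonneg]
    exact dist_triangle_right _ _ _
  rw [memLp_ofReal_iff_integrable_rpow hp0 mF fun _ => dist_nonneg] at lF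
  rw [memLp_ofReal_iff_integrable_rpow hp0 mG fun _ => dist_nonneg] at lG
  rw [memLp_ofReal_iff_integrable_rpow hp0 mD fun _ => dist_nonneg] at lD
  refine integral_mono_of_nonneg (.of_forall fun _ => by positivity) lD.integral_prod_left ?_
  filter_upwards [lF.prod_right_ae, lG.prod_right_ae, lD.prod_right_ae] with w iF iG iD
  have key := abs_integral_rpow_sub_integral_rpow_le hp
    (mF.comp measurable_prodMk_left) (mG.comp measurable_prodMk_left)
    (mD.comp measurable_prodMk_left) (fun _ => dist_nonneg) (fun _ => dist_nonneg)
    (fun w' => abs_dist_sub_le _ _ z₀) iF iG iD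
  have eF : (∫ w', F (w, w') ^ p ∂π) ^ (1 / p) = eccOut p ωX μX z₀ w.1 := by
    rw [eccOut, ← h1.map_eq, integral_map h1.aemeasurable]
    exact (((hX.measurable_dist z₀).comp measurable_prodMk_left).pow_const p).aestronglyMeasurable
  have eG : (∫ w', G (w, w') ^ p ∂π) ^ (1 / p) = eccOut p ωY μY z₀ w.2 := by
    rw [eccOut, ← h2.map_eq, integral_map h2.aemeasurable]
    exact (((hY.measurable_dist z₀).comp measurable_prodMk_left).pow_const p).aestronglyMeasurable
  simp only [Function.comp_apply, eF, eG] at key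
  have hD : 0 ≤ ∫ w', D (w, w') ^ p ∂π := integral_nonneg fun _ => Real.rpow_nonneg dist_nonneg p
  calc dist (eccOut p ωX μX z₀ w.1) (eccOut p ωY μY z₀ w.2) ^ p
      ≤ ((∫ w', D (w, w') ^ p ∂π) ^ (1 / p)) ^ p :=
        Real.rpow_le_rpow dist_nonneg key hp0.le
    _ = ∫ w', D (w, w') ^ p ∂π := rpow_one_div_rpow hp hD

end Network

/-- **First and size lower bounds (FLB and SzLB)**: the `Z`-Gromov–Wasserstein distance
is bounded below by half the Wasserstein distance (on `ℝ`) between the pushforwards of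
the measures under the outgoing eccentricity functions, which in turn is bounded below
by half the difference of sizes. -/
theorem gw_first_and_size_lower_bounds
    {X Y Z : Type*}
    [MeasurableSpace X] [TopologicalSpace X] [PolishSpace X] [BorelSpace X]
    [MeasurableSpace Y] [TopologicalSpace Y] [PolishSpace Y] [BorelSpace Y]
    [MetricSpace Z] [MeasurableSpace Z] [BorelSpace Z] [TopologicalSpace.SeparableSpace Z]
    (p : ℝ) (hp : 1 ≤ p) (z₀ : Z)
    (ωX : X × X → Z) (μX : Measure X) (hX : IsNetwork p ωX μX)
    (ωY : Y × Y → Z) (μY : Measure Y) (hY : IsNetwork p ωY μY) :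
    GW p ωX μX ωY μY ≥
      (1 / 2) * Wp p (μX.map (eccOut p ωX μX z₀)) (μY.map (eccOut p ωY μY z₀)) ∧
    (1 / 2) * Wp p (μX.map (eccOut p ωX μX z₀)) (μY.map (eccOut p ωY μY z₀)) ≥
      (1 / 2) * |sizeP p ωX μX z₀ - sizeP p ωY μY z₀| := by
  have := hX.prob
  have := hY.prob
  constructor
  · refine mul_le_mul_of_nonneg_left ?_ (by norm_num)
    refine le_csInf ((Couplings.nonempty μX μY).image _) ?_
    rintro _ ⟨π, hπ, rfl⟩
    exact Wp_map_eccOut_le_dis hp hX hY z₀ hπ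
  · refine mul_le_mul_of_nonneg_left ?_ (by norm_num)
    have := Measure.isProbabilityMeasure_map (μ := μX) (hX.measurable_eccOut z₀).aemeasurable
    have := Measure.isProbabilityMeasure_map (μ := μY) (hY.measurable_eccOut z₀).aemeasurable
    rw [hX.sizeP_eq hp z₀, hY.sizeP_eq hp z₀]
    exact abs_moment_sub_moment_le_Wp hp (hX.integrable_map_eccOut hp z₀)
      (hY.integrable_map_eccOut hp z₀)
end
end

section
/- The Wasserstein distance is a Z-Gromov–Wasserstein distance: Let (Z, d_Z) be a separable metric space, p ∈ [1,∞), and let μ and ν be Borel probability measures on Z with finite p-th moments. Equip Z (as target space) with the rescaled metric 2·d_Z, and consider the networks X = (Z, ω, μ) and Y = (Z, ω, ν), where ω : Z × Z → Z is the projection onto the first coordinate, ω(z, z') = z. Then GW_p^{(Z, 2·d_Z)}(X, Y) = W_p(μ, ν), the Wasserstein p-distance between μ and ν with respect to d_Z. -/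
open MeasureTheory

noncomputable section

/-- The `p`-distortion of a coupling `π`, for kernels valued in `Z'` equipped with an
explicit distance function `d : Z' → Z' → ℝ`. -/
def disD {X Y Z' : Type*} [MeasurableSpace X] [MeasurableSpace Y]
    (p : ℝ) (d : Z' → Z' → ℝ) (ωX : X × X → Z') (ωY : Y × Y → Z')
    (π : Measure (X × Y)) : ℝ :=
  (∫ w : X × Y, ∫ w' : X × Y, d (ωX (w.1, w'.1)) (ωY (w.2, w'.2)) ^ p ∂π ∂π) ^ (1 / p)

/-- The Gromov–Wasserstein `p`-distance for kernels valued in `Z'` equipped with an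
explicit distance function `d`. -/
def GWD {X Y Z' : Type*} [MeasurableSpace X] [MeasurableSpace Y]
    (p : ℝ) (d : Z' → Z' → ℝ) (ωX : X × X → Z') (μX : Measure X)
    (ωY : Y × Y → Z') (μY : Measure Y) : ℝ :=
  (1 / 2) * sInf (disD p d ωX ωY '' Couplings μX μY)

/-- When both kernels are first projections, the distortion for the metric `2 * dist` of a
probability measure is twice its transport cost. -/
theorem disD_two_mul_dist_fst {Z : Type*} [PseudoMetricSpace Z] [MeasurableSpace Z]
    {p : ℝ} (hp : 0 < p) (π : Measure (Z × Z)) [IsProbabilityMeasure π] :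
    disD p (fun a b => 2 * dist a b) (fun w : Z × Z => w.1) (fun w : Z × Z => w.1) π =
      2 * (∫ q, dist q.1 q.2 ^ p ∂π) ^ (1 / p) := by
  have h2 : (0 : ℝ) ≤ 2 := zero_le_two
  simp only [disD, integral_const, probReal_univ, one_smul, Real.mul_rpow h2 dist_nonneg,
    integral_const_mul]
  rw [Real.mul_rpow (Real.rpow_nonneg h2 p)
    (integral_nonneg fun q => Real.rpow_nonneg dist_nonneg p), ← Real.rpow_mul h2,
    mul_one_div_cancel hp.ne', Real.rpow_one]

open scoped Pointwise in
/-- The set of distortions is the set of transport costs, scaled by two. -/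
theorem image_disD_two_mul_dist_fst {Z : Type*} [PseudoMetricSpace Z] [MeasurableSpace Z]
    {p : ℝ} (hp : 0 < p) (μ ν : Measure Z) :
    disD p (fun a b => 2 * dist a b) (fun w : Z × Z => w.1) (fun w : Z × Z => w.1) ''
        Couplings μ ν =
      (2 : ℝ) • ((fun π : Measure (Z × Z) => (∫ q, dist q.1 q.2 ^ p ∂π) ^ (1 / p)) ''
        Couplings μ ν) := by
  rw [← Set.image_smul, Set.image_image]
  refine Set.image_congr fun π hπ => ?_
  have := hπ.1
  exact disD_two_mul_dist_fst hp π

/-- **The Wasserstein distance is a `Z`-Gromov–Wasserstein distance**: for Borel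
probability measures `μ, ν` on a separable metric space `Z` with finite `p`-th moments,
taking the target space `Z` with the rescaled metric `2·d_Z` and the networks
`X = (Z, ω, μ)`, `Y = (Z, ω, ν)` with `ω` the projection onto the first coordinate,
the `(Z, 2·d_Z)`-Gromov–Wasserstein distance between `X` and `Y` equals `W_p(μ, ν)`. -/
theorem wasserstein_as_gw
    {Z : Type*} [MetricSpace Z] [MeasurableSpace Z] [BorelSpace Z]
    [TopologicalSpace.SeparableSpace Z]
    (p : ℝ) (hp : 1 ≤ p)
    (μ ν : Measure Z) [IsProbabilityMeasure μ] [IsProbabilityMeasure ν]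
    (hμ : ∃ z₀ : Z, (∫⁻ z, ENNReal.ofReal (dist z z₀ ^ p) ∂μ) < ⊤)
    (hν : ∃ z₀ : Z, (∫⁻ z, ENNReal.ofReal (dist z z₀ ^ p) ∂ν) < ⊤) :
    GWD p (fun a b => 2 * dist a b)
        (fun w : Z × Z => w.1) μ (fun w : Z × Z => w.1) ν = Wp p μ ν := by
  rw [GWD, Wp, image_disD_two_mul_dist_fst (by linarith), Real.sInf_smul_of_nonneg zero_le_two,
    smul_eq_mul]
  ring
end
end
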